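/- Let a be a base sequence and let (r(k))_{k∈ℕ} be a sequence of nonnegative reals converging to a nonnegative real r. Suppose either (i) r has infinitely many nonzero digits with respect to a, or (ii) r(k) ≥ r for all k. Then j_a(r(k)) → j_a(r) as k → ∞ in 2^ℕ with the product topology; that is, for every n ≥ 1 there is K such that for all k ≥ K, n ∈ j_a(r(k)) if and only if n ∈ j_a(r). -/

import Mathlib

open Set Filter
open scoped ENNReal

/-- `a₀ a₁ ⋯ a_{n-1}` as a real number: the product of the first `n` terms of the
base sequence (the paper's `a₁ ⋯ a_n`, re-indexed from 0). -/
noncomputable def bProd (a : ℕ → ℕ) (n : ℕ) : ℝ := ∏ k ∈ Finset.range n, (a k : ℝ)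

/-- The `n`-th digit (0-indexed; the paper's `(n+1)`-st digit) of the nonnegative
real `r` in base `a`:  `r_n = ⌊a₁⋯a_n (r - ⌊r⌋)⌋ - a_n ⌊a₁⋯a_{n-1} (r - ⌊r⌋)⌋`. -/
noncomputable def digit (a : ℕ → ℕ) (r : ℝ) (n : ℕ) : ℤ :=
  ⌊bProd a (n + 1) * Int.fract r⌋ - (a n : ℤ) * ⌊bProd a n * Int.fract r⌋

/-- `j_a(r) = { n : r_n ≠ r_{n+1} }`. -/
def jSet (a : ℕ → ℕ) (r : ℝ) : Set ℕ := {n | digit a r n ≠ digit a r (n + 1)}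

/-- An ideal of subsets of ℕ: closed under subsets and finite unions, containing
all singletons (hence nonempty). -/
def IsIdeal (I : Set (Set ℕ)) : Prop :=
  (∀ ⦃x y : Set ℕ⦄, x ∈ I → y ⊆ x → y ∈ I) ∧
  (∀ ⦃x y : Set ℕ⦄, x ∈ I → y ∈ I → x ∪ y ∈ I) ∧
  (∀ n : ℕ, ({n} : Set ℕ) ∈ I)

/-- Translation invariance of a family of subsets of ℕ. -/
def TransInv (I : Set (Set ℕ)) : Prop :=
  ∀ x ∈ I, ({n | ∃ m ∈ x, n = m + 1} ∈ I) ∧ ({n | n + 1 ∈ x} ∈ I)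

/-- A tall family: every infinite set of naturals has an infinite subset in the family. -/
def TallIdeal (I : Set (Set ℕ)) : Prop :=
  ∀ x : Set ℕ, x.Infinite → ∃ y, y ⊆ x ∧ y.Infinite ∧ y ∈ I

/-- The base sequence `a` is adapted to `I` if `{n : a_n ≠ a_{n+1}} ∈ I`. -/
def AdaptedTo (a : ℕ → ℕ) (I : Set (Set ℕ)) : Prop := {n | a n ≠ a (n + 1)} ∈ I

/-- A lower semicontinuous submeasure on subsets of ℕ. -/
def IsLscSubmeasure (φ : Set ℕ → ℝ≥0∞) : Prop :=
  φ ∅ = 0 ∧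
  (∀ ⦃x y : Set ℕ⦄, x ⊆ y → φ x ≤ φ y) ∧
  (∀ x y : Set ℕ, φ (x ∪ y) ≤ φ x + φ y) ∧
  (∀ n : ℕ, 0 < φ {n} ∧ φ {n} < ⊤) ∧
  (∀ x : Set ℕ, φ x = ⨆ n : ℕ, φ (x ∩ {k | k < n}))

/-- `Exh(φ) = { x ⊆ ℕ : φ(x \ {0,…,n-1}) → 0 }`. -/
def Exh (φ : Set ℕ → ℝ≥0∞) : Set (Set ℕ) :=
  {x | Filter.Tendsto (fun n => φ (x \ {k | k < n})) Filter.atTop (nhds 0)}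

/-- `pr(a)`: the set of primes dividing `a_n` for all but finitely many `n`. -/
def prSet (a : ℕ → ℕ) : Set ℕ := {p | p.Prime ∧ ∀ᶠ n in Filter.atTop, p ∣ a n}

/-- A base sequence is uniform if every prime dividing some `a_n` divides `a_n`
for all but finitely many `n`. -/
def UniformBase (a : ℕ → ℕ) : Prop :=
  ∀ p : ℕ, p.Prime → (∃ n, p ∣ a n) → ∀ᶠ n in Filter.atTop, p ∣ a n

/-- `ℚ_a`, viewed as a set of real numbers: fractions `k/l` with every prime
divisor of `l` in `pr(a)`. -/
def Qa (a : ℕ → ℕ) : Set ℝ :=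
  {r | ∃ (k : ℤ) (l : ℕ), 0 < l ∧ (∀ p : ℕ, p.Prime → p ∣ l → p ∈ prSet a) ∧
    r = (k : ℝ) / (l : ℝ)}

/-- `H = { r ∈ ℝ : j_a(|r|) ∈ I }`. -/
def Hset (a : ℕ → ℕ) (I : Set (Set ℕ)) : Set ℝ := {r | jSet a |r| ∈ I}

/-- `ρ(r,s) = φ(j_a(|r-s|)) + |r-s|`. -/
noncomputable def rho (a : ℕ → ℕ) (φ : Set ℕ → ℝ≥0∞) (r s : ℝ) : ℝ :=
  (φ (jSet a |r - s|)).toReal + |r - s|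

theorem bProd_succ (a : ℕ → ℕ) (n : ℕ) : bProd a (n + 1) = bProd a n * a n :=
  Finset.prod_range_succ _ _

theorem bProd_pos {a : ℕ → ℕ} (ha : ∀ n, 2 ≤ a n) (n : ℕ) : 0 < bProd a n :=
  Finset.prod_pos fun k _ => Nat.cast_pos.2 (by have := ha k; omega)

theorem floor_bProd_mul_fract (a : ℕ → ℕ) (x : ℝ) (n : ℕ) :
    ⌊bProd a n * Int.fract x⌋ =
      ⌊bProd a n * x⌋ - (∏ k ∈ Finset.range n, (a k : ℤ)) * ⌊x⌋ := by
  rw [← Int.floor_sub_intCast, Int.fract, mul_sub]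
  simp [bProd]

/-- Digits can be computed without first passing to the fractional part. -/
theorem digit_eq (a : ℕ → ℕ) (x : ℝ) (n : ℕ) :
    digit a x n = ⌊bProd a (n + 1) * x⌋ - (a n : ℤ) * ⌊bProd a n * x⌋ := by
  rw [digit, floor_bProd_mul_fract, floor_bProd_mul_fract, Finset.prod_range_succ]
  ring

/-- If `x` has infinitely many nonzero digits, no `a₀ ⋯ a_{n-1} x` is an integer. -/
theorem bProd_mul_ne_intCast {a : ℕ → ℕ} {x : ℝ} (h : {n | digit a x n ≠ 0}.Infinite)
    (n : ℕ) (z : ℤ) : bProd a n * x ≠ z := by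
  intro hz
  have key : ∀ m, n ≤ m → ∃ w : ℤ, bProd a m * x = w := by
    intro m hm
    induction m, hm using Nat.le_induction with
    | base => exact ⟨z, hz⟩
    | succ m _ ih =>
      obtain ⟨w, hw⟩ := ih
      refine ⟨a m * w, ?_⟩
      rw [bProd_succ, mul_right_comm, hw]
      push_cast
      ring
  obtain ⟨m, hm, hnm⟩ := h.exists_gt n
  obtain ⟨w, hw⟩ := key m hnm.le
  refine hm ?_
  have hw' : bProd a (m + 1) * x = ((a m * w : ℤ) : ℝ) := by
    rw [bProd_succ, mul_right_comm, hw]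
    push_cast
    ring
  rw [digit_eq, hw, hw', Int.floor_intCast, Int.floor_intCast, sub_self]

/-- Lemma on convergence of `j_a`. -/
theorem jSet_converge (a : ℕ → ℕ) (ha : ∀ n, 2 ≤ a n)
    (r : ℝ) (hr : 0 ≤ r) (u : ℕ → ℝ) (hu : ∀ k, 0 ≤ u k)
    (hconv : Filter.Tendsto u Filter.atTop (nhds r))
    (h : {n | digit a r n ≠ 0}.Infinite ∨ ∀ k, r ≤ u k) :
    ∀ n : ℕ, ∀ᶠ k in Filter.atTop, (n ∈ jSet a (u k) ↔ n ∈ jSet a r) := by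
  have floor_eq : ∀ n, ∀ᶠ k in atTop, ⌊bProd a n * u k⌋ = ⌊bProd a n * r⌋ := by
    intro n
    have hlim : Tendsto (fun k => bProd a n * u k) atTop (nhds (bProd a n * r)) :=
      hconv.const_mul _
    have lower : ∀ᶠ k in atTop, (⌊bProd a n * r⌋ : ℝ) ≤ bProd a n * u k := by
      rcases h with h | h
      · have hlt : (⌊bProd a n * r⌋ : ℝ) < bProd a n * r :=
          (Int.floor_le _).lt_of_ne (bProd_mul_ne_intCast h n _).symm
        exact (hlim.eventually_const_lt hlt).mono fun _ hk => hk.le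
      · exact Eventually.of_forall fun k => (Int.floor_le _).trans
          (mul_le_mul_of_nonneg_left (h k) (bProd_pos ha n).le)
    filter_upwards [lower, hlim.eventually_lt_const (Int.lt_floor_add_one _)] with k h₁ h₂
    exact Int.floor_eq_iff.2 ⟨h₁, h₂⟩
  intro n
  filter_upwards [floor_eq n, floor_eq (n + 1), floor_eq (n + 2)] with k h₀ h₁ h₂
  simp only [jSet, mem_ofPred_eq, digit_eq, h₀, h₁, h₂]
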